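/- Let G and H be two directed trees on the same vertex set V = {0,…,p−1} (p ≥ 2), each with a single self-loop at its root, given by parent functions par_G with root r_G and par_H with root r_H, with associated third-order models Θ_G and Θ_H. Say that G and H define the same third-order ideal if for every real polynomial f in the variables (s_{ij})_{i,j∈V} and (t_{ijk})_{i,j,k∈V}: f(S,T) = 0 for all θ ∈ Θ_G if and only if f(S,T) = 0 for all θ ∈ Θ_H. Then G and H define the same third-order ideal if and only if both of the following hold: (i) for every vertex i ∈ V, the level of i in G equals the level of i in H; and (ii) for every pair of vertices i, j ∈ V, the top of the shortest equitrek between i and j in G equals the top of the shortest equitrek between i and j in H. -/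

import Mathlib

open Matrix

/-- The order-`n` steady-state cumulant tensor. -/
noncomputable def steadyCumulant (p n : ℕ) (A : Matrix (Fin p) (Fin p) ℝ)
    (w : Fin p → ℝ) (i : Fin n → Fin p) : ℝ :=
  ∑' l : ℕ, ∑ r : Fin p, w r * ∏ m : Fin n, (A ^ l) (i m) r

/-- `(u,v)` is an edge of the directed tree with parent function `par`, root `r`,
and a single self-loop at the root. -/
def treeEdge {p : ℕ} (par : Fin p → Fin p) (r u v : Fin p) : Prop :=
  (v ≠ r ∧ u = par v) ∨ (u = r ∧ v = r)

/-- Membership in the third-order model parameter space `Θ` of the directed tree. -/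
def treeModel {p : ℕ} (par : Fin p → Fin p) (r : Fin p)
    (A : Matrix (Fin p) (Fin p) ℝ) (w₂ w₃ : Fin p → ℝ) : Prop :=
  (∀ u v : Fin p, ¬treeEdge par r u v → A v u = 0) ∧
  (∀ μ ∈ spectrum ℂ (A.map (algebraMap ℝ ℂ)), ‖μ‖ < 1) ∧
  (∀ i : Fin p, 0 < w₂ i) ∧ (∀ i : Fin p, w₃ i ≠ 0)

/-- `a` is an ancestor of `i` in the tree with parent function `par`. -/
def ancestor {p : ℕ} (par : Fin p → Fin p) (a i : Fin p) : Prop :=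
  ∃ n : ℕ, par^[n] i = a

/-- Evaluation of a polynomial in the variables `s_{ij}` and `t_{ijk}` at the second-
and third-order cumulants of a model point `(A, w₂, w₃)`. -/
noncomputable def evalCumulants (p : ℕ) (A : Matrix (Fin p) (Fin p) ℝ)
    (w₂ w₃ : Fin p → ℝ)
    (f : MvPolynomial ((Fin p × Fin p) ⊕ (Fin p × Fin p × Fin p)) ℝ) : ℝ :=
  MvPolynomial.eval
    (Sum.elim (fun x : Fin p × Fin p => steadyCumulant p 2 A w₂ ![x.1, x.2])
      (fun x : Fin p × Fin p × Fin p => steadyCumulant p 3 A w₃ ![x.1, x.2.1, x.2.2])) f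

/-- `l` is the top of the shortest equitrek between `i` and `j` in the directed tree
with parent function `par`, root `r`, where `hreach` witnesses that every vertex
reaches the root (levels are given by `Nat.find`). -/
def isEquitrekTop {p : ℕ} (par : Fin p → Fin p) (r : Fin p)
    (hreach : ∀ i : Fin p, ∃ n : ℕ, par^[n] i = r) (i j l : Fin p) : Prop :=
  (Nat.find (hreach i) = Nat.find (hreach j) ∧
      ancestor par l i ∧ ancestor par l j ∧
      ∀ a : Fin p, ancestor par a i → ancestor par a j → ancestor par a l) ∨
    (Nat.find (hreach i) ≠ Nat.find (hreach j) ∧ l = r)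

/-- `par` is a rooted tree with root `r` and level function `lev`. -/
def IsLev {p : ℕ} (par : Fin p → Fin p) (r : Fin p) (lev : Fin p → ℕ) : Prop :=
  ∀ i k, par^[k] i = r ↔ lev i ≤ k

theorem isLev_find {p : ℕ} (par : Fin p → Fin p) (r : Fin p) (hr : par r = r)
    (hreach : ∀ i : Fin p, ∃ n : ℕ, par^[n] i = r) :
    IsLev par r (fun i => Nat.find (hreach i)) := by
  intro i k
  constructor
  · intro h
    exact Nat.find_min' _ h
  · intro h
    obtain ⟨m, rfl⟩ := Nat.exists_eq_add_of_le h
    rw [add_comm, Function.iterate_add_apply, Nat.find_spec (hreach i)]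
    exact Function.iterate_fixed hr m

namespace IsLev
variable {p : ℕ} {par : Fin p → Fin p} {r : Fin p} {lev : Fin p → ℕ}

theorem lev_root (h : IsLev par r lev) : lev r = 0 := by
  have := (h r 0).1 rfl
  omega

theorem par_root (h : IsLev par r lev) : par r = r := by
  have := (h r 1).2 (by rw [h.lev_root]; omega)
  simpa using this

theorem lev_eq_zero (h : IsLev par r lev) {i : Fin p} : lev i = 0 ↔ i = r := by
  have := h i 0
  simp at this
  exact this.symm

theorem lev_iter (h : IsLev par r lev) (i : Fin p) (k : ℕ) : lev (par^[k] i) = lev i - k := by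
  have key : ∀ m, lev (par^[k] i) ≤ m ↔ lev i - k ≤ m := by
    intro m
    rw [← h, ← Function.iterate_add_apply, h]
    omega
  exact le_antisymm ((key _).2 le_rfl) ((key _).1 le_rfl)

theorem lev_par (h : IsLev par r lev) (i : Fin p) : lev (par i) = lev i - 1 := h.lev_iter i 1

theorem iter_lev (h : IsLev par r lev) (i : Fin p) : par^[lev i] i = r := (h i _).2 le_rfl

theorem lev_ancestor (h : IsLev par r lev) {a i : Fin p} (ha : ancestor par a i) :
    lev a ≤ lev i ∧ par^[lev i - lev a] i = a := by
  obtain ⟨n, rfl⟩ := ha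
  rw [h.lev_iter]
  refine ⟨by omega, ?_⟩
  rcases le_total n (lev i) with hn | hn
  · congr 2
    omega
  · rw [(h i n).2 hn, h]
    omega

/-- induction on the level -/
theorem ind (h : IsLev par r lev) {P : Fin p → Prop} (h0 : P r)
    (h1 : ∀ i, i ≠ r → P (par i) → P i) (i : Fin p) : P i := by
  induction hn : lev i generalizing i with
  | zero => rw [h.lev_eq_zero.1 hn]; exact h0
  | succ n ih =>
    apply h1
    · intro hi
      rw [hi, h.lev_root] at hn
      omega
    · apply ih
      rw [h.lev_par]; omega

end IsLev

/-- the paths up from `i` and `j` meet first after `K` steps, at `t` -/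
def Meet {p : ℕ} (par : Fin p → Fin p) (i j : Fin p) (K : ℕ) (t : Fin p) : Prop :=
  par^[K] i = t ∧ par^[K] j = t ∧ ∀ k < K, par^[k] i ≠ par^[k] j

section meet
variable {p : ℕ} {par : Fin p → Fin p} {r : Fin p} {lev : Fin p → ℕ}

theorem exists_meet (h : IsLev par r lev) (i j : Fin p) : ∃ K t, Meet par i j K t := by
  classical
  have hex : ∃ k, par^[k] i = par^[k] j :=
    ⟨max (lev i) (lev j), by
      rw [(h i _).2 (le_max_left _ _), (h j _).2 (le_max_right _ _)]⟩
  exact ⟨Nat.find hex, _, rfl, (Nat.find_spec hex).symm, fun k hk => Nat.find_min hex hk⟩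

theorem meet_root (h : IsLev par r lev) (i : Fin p) : Meet par r i (lev i) r := by
  refine ⟨Function.iterate_fixed h.par_root _, h.iter_lev i, fun k hk e => ?_⟩
  rw [Function.iterate_fixed h.par_root] at e
  have := (h i k).1 e.symm
  omega

theorem Meet.le_lev (h : IsLev par r lev) {i j t : Fin p} {K : ℕ} (hl : lev i = lev j)
    (hm : Meet par i j K t) : K ≤ lev i := by
  by_contra hlt
  push Not at hlt
  apply hm.2.2 _ hlt
  rw [h.iter_lev, hl, h.iter_lev]

theorem Meet.unique {i j t t' : Fin p} {K K' : ℕ}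
    (hm : Meet par i j K t) (hm' : Meet par i j K' t') : K = K' ∧ t = t' := by
  have : K = K' := by
    rcases lt_trichotomy K K' with hl | hl | hl
    · exact absurd (hm.1.trans hm.2.1.symm) (hm'.2.2 _ hl)
    · exact hl
    · exact absurd (hm'.1.trans hm'.2.1.symm) (hm.2.2 _ hl)
  subst this
  exact ⟨rfl, hm.1.symm.trans hm'.1⟩

/-- top of equitrek for vertices on the same level -/
def IsEqTop {p : ℕ} (par : Fin p → Fin p) (i j l : Fin p) : Prop :=
  ancestor par l i ∧ ancestor par l j ∧
      ∀ a : Fin p, ancestor par a i → ancestor par a j → ancestor par a l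

theorem isEqTop_iff_meet (h : IsLev par r lev) {i j l : Fin p} (hl : lev i = lev j) :
    IsEqTop par i j l ↔ Meet par i j (lev i - lev l) l := by
  constructor
  · rintro ⟨h1, h2, h3⟩
    obtain ⟨a1, a2⟩ := h.lev_ancestor h1
    obtain ⟨b1, b2⟩ := h.lev_ancestor h2
    refine ⟨a2, by rw [hl]; exact b2, fun k hk e => ?_⟩
    have := (h.lev_ancestor (h3 (par^[k] i) ⟨k, rfl⟩ ⟨k, e.symm⟩)).1
    rw [h.lev_iter] at this
    omega
  · rintro ⟨h1, h2, h3⟩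
    refine ⟨⟨_, h1⟩, ⟨_, h2⟩, fun a ha hb => ?_⟩
    obtain ⟨a1, a2⟩ := h.lev_ancestor ha
    obtain ⟨b1, b2⟩ := h.lev_ancestor hb
    by_cases hk : lev i - lev a < lev i - lev l
    · exact absurd (a2.trans (by rw [hl]; exact b2.symm)) (h3 _ hk)
    · refine ⟨(lev i - lev a) - (lev i - lev l), ?_⟩
      have e : (lev i - lev a) - (lev i - lev l) + (lev i - lev l) = lev i - lev a := by omega
      have h4 : par^[(lev i - lev a) - (lev i - lev l)] (par^[lev i - lev l] i) = a := by
        rw [← Function.iterate_add_apply, e, a2]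
      rwa [h1] at h4

theorem meet_isEqTop (h : IsLev par r lev) {i j l : Fin p} {K : ℕ} (hl : lev i = lev j)
    (hm : Meet par i j K l) : IsEqTop par i j l ∧ K = lev i - lev l := by
  have hK := hm.le_lev h hl
  have : K = lev i - lev l := by
    rw [← hm.1, h.lev_iter]; omega
  rw [isEqTop_iff_meet h hl, ← this]
  exact ⟨hm, rfl⟩

theorem meet_of_lt (h : IsLev par r lev) {i j : Fin p} (hl : lev i ≠ lev j) :
    Meet par i j (max (lev i) (lev j)) r := by
  refine ⟨(h i _).2 (le_max_left _ _), (h j _).2 (le_max_right _ _), fun k hk e => ?_⟩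
  have := congrArg lev e
  rw [h.lev_iter, h.lev_iter] at this
  omega

/-- Meeting data of two trees with the same levels and tops agree. -/
theorem meet_transfer {par' : Fin p → Fin p} (h : IsLev par r lev) (h' : IsLev par' r lev)
    (htop : ∀ i j l, lev i = lev j → IsEqTop par i j l → IsEqTop par' i j l)
    {i j t : Fin p} {K : ℕ} (hm : Meet par i j K t) : Meet par' i j K t := by
  by_cases hl : lev i = lev j
  · obtain ⟨h1, h2⟩ := meet_isEqTop h hl hm
    rw [h2]
    exact (isEqTop_iff_meet h' hl).1 (htop _ _ _ hl h1)
  · obtain ⟨rfl, rfl⟩ := hm.unique (meet_of_lt h hl)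
    exact meet_of_lt h' hl

/-- tuple version of `Meet` -/
def MeetT {p : ℕ} {n : ℕ} (par : Fin p → Fin p) (i : Fin n → Fin p) (K : ℕ) (t : Fin p) : Prop :=
  (∀ m, par^[K] (i m) = t) ∧ ∀ k < K, ¬ ∃ u, ∀ m, par^[k] (i m) = u

theorem exists_meetT (h : IsLev par r lev) {n : ℕ} (i : Fin n → Fin p) :
    ∃ K t, MeetT par i K t := by
  classical
  have hex : ∃ k, ∃ u, ∀ m, par^[k] (i m) = u :=
    ⟨Finset.univ.sup (fun m => lev (i m)), r, fun m => (h _ _).2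
      (Finset.le_sup (f := fun m => lev (i m)) (Finset.mem_univ m))⟩
  obtain ⟨t, ht⟩ := Nat.find_spec hex
  exact ⟨Nat.find hex, t, ht, fun k hk => Nat.find_min hex hk⟩

theorem iterate_eq_of_le {i j : Fin p} {k K : ℕ} (hk : k ≤ K) (e : par^[k] i = par^[k] j) :
    par^[K] i = par^[K] j := by
  obtain ⟨m, rfl⟩ := Nat.exists_eq_add_of_le hk
  rw [add_comm, Function.iterate_add_apply, Function.iterate_add_apply, e]

theorem Meet.le_of_eq {i j t : Fin p} {k K : ℕ} (hm : Meet par i j K t)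
    (e : par^[k] i = par^[k] j) : K ≤ k := by
  by_contra hlt
  exact hm.2.2 k (by omega) e

theorem meetT_transfer {par' : Fin p → Fin p} (h : IsLev par r lev)
    (htr : ∀ i j K t, Meet par i j K t → Meet par' i j K t) {n : ℕ}
    {i : Fin n → Fin p} {K : ℕ} {t : Fin p} (hm : MeetT par i K t) : MeetT par' i K t := by
  rcases Nat.eq_zero_or_pos K with rfl | hK
  · exact ⟨fun m => hm.1 m, fun k hk => absurd hk (by omega)⟩
  have hnc := hm.2 (K-1) (by omega)
  have : ∃ a b, par^[K-1] (i a) ≠ par^[K-1] (i b) := by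
    by_contra hall
    push Not at hall
    apply hnc
    rcases isEmpty_or_nonempty (Fin n) with he | ⟨⟨a⟩⟩
    · exact ⟨t, fun m => he.elim m⟩
    · exact ⟨_, fun m => hall m a⟩
  obtain ⟨a, b, hab⟩ := this
  have hmeet : Meet par (i a) (i b) K t := by
    refine ⟨hm.1 a, hm.1 b, fun k hk e => hab ?_⟩
    exact iterate_eq_of_le (by omega) e
  have hmeet' := htr _ _ _ _ hmeet
  refine ⟨fun m => ?_, fun k hk => ?_⟩
  · obtain ⟨K', t', hmm⟩ := exists_meet h (i m) (i a)
    have hle := hmm.le_of_eq (k := K) ((hm.1 m).trans (hm.1 a).symm)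
    have hmm' := htr _ _ _ _ hmm
    rw [iterate_eq_of_le hle (hmm'.1.trans hmm'.2.1.symm)]
    exact hmeet'.1
  · rintro ⟨u, hu⟩
    exact hmeet'.2.2 k hk ((hu a).trans (hu b).symm)

end meet
/-- the matrix of a tree with edge weights `lam` -/
def treeMat {p : ℕ} (par : Fin p → Fin p) (lam : Fin p → ℝ) : Matrix (Fin p) (Fin p) ℝ :=
  fun v u => if u = par v then lam v else 0

section cum
variable {p : ℕ} {par : Fin p → Fin p} {r : Fin p} {lev : Fin p → ℕ}

theorem treeMat_pow_succ (lam : Fin p → ℝ) (l : ℕ) (v u : Fin p) :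
    (treeMat par lam ^ (l+1)) v u = lam v * (treeMat par lam ^ l) (par v) u := by
  rw [pow_succ', Matrix.mul_apply]
  simp [treeMat]

/-- summand of the cumulant -/
noncomputable def cterm {p n : ℕ} (par : Fin p → Fin p) (lam w : Fin p → ℝ)
    (i : Fin n → Fin p) (l : ℕ) : ℝ :=
  ∑ r : Fin p, w r * ∏ m : Fin n, (treeMat par lam ^ l) (i m) r

/-- cumulant of a tree -/
noncomputable def cum {p n : ℕ} (par : Fin p → Fin p) (lam w : Fin p → ℝ)
    (i : Fin n → Fin p) : ℝ := ∑' l, cterm par lam w i l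

theorem steady_eq_cum {n : ℕ} (lam w : Fin p → ℝ) (i : Fin n → Fin p) :
    steadyCumulant p n (treeMat par lam) w i = cum par lam w i := rfl

theorem cterm_succ {n : ℕ} (lam w : Fin p → ℝ) (i : Fin n → Fin p) (l : ℕ) :
    cterm par lam w i (l+1) = (∏ m, lam (i m)) * cterm par lam w (par ∘ i) l := by
  simp only [cterm, treeMat_pow_succ, Finset.prod_mul_distrib, Finset.mul_sum]
  refine Finset.sum_congr rfl fun u _ => ?_
  simp only [Function.comp]
  ring

theorem cterm_zero_const {n : ℕ} (hn : n ≠ 0) (lam w : Fin p → ℝ) (t : Fin p) :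
    cterm par lam w (fun _ : Fin n => t) 0 = w t := by
  simp [cterm, Matrix.one_apply, hn]

theorem cterm_zero_nonconst {n : ℕ} (lam w : Fin p → ℝ) (i : Fin n → Fin p)
    (hi : ¬ ∃ u, ∀ m, i m = u) : cterm par lam w i 0 = 0 := by
  apply Finset.sum_eq_zero
  intro u _
  push Not at hi
  obtain ⟨m, hm⟩ := hi u
  rw [Finset.prod_eq_zero (Finset.mem_univ m), mul_zero]
  simp [hm]

theorem cterm_root (h : IsLev par r lev) {n : ℕ} (hn : n ≠ 0) (lam w : Fin p → ℝ) (l : ℕ) :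
    cterm par lam w (fun _ : Fin n => r) l = (lam r ^ n) ^ l * w r := by
  induction l with
  | zero => rw [cterm_zero_const hn]; simp
  | succ l ih =>
    have : par ∘ (fun _ : Fin n => r) = fun _ => r := by
      funext x; exact h.par_root
    rw [cterm_succ, this, ih]
    simp only [Finset.prod_const, Finset.card_univ, Fintype.card_fin]
    ring

theorem abs_pow_lt {c : ℝ} (hc : |c| < 1) {n : ℕ} (hn : n ≠ 0) : |c ^ n| < 1 := by
  rw [abs_pow]
  exact pow_lt_one₀ (abs_nonneg _) hc hn

/-- Induction on tuples: from the root tuple downwards. -/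
theorem tuple_ind (h : IsLev par r lev) {n : ℕ} {P : (Fin n → Fin p) → Prop}
    (h0 : P (fun _ => r)) (h1 : ∀ i, P (par ∘ i) → P i) (i : Fin n → Fin p) : P i := by
  have : ∀ K, ∀ i : Fin n → Fin p, (∀ m, par^[K] (i m) = r) → P i := by
    intro K
    induction K with
    | zero =>
      intro i hi
      have : i = fun _ => r := funext hi
      rw [this]; exact h0
    | succ K ih =>
      intro i hi
      exact h1 i (ih _ fun m => by simpa using hi m)
  exact this (Finset.univ.sup (fun m => lev (i m))) i fun m => (h _ _).2
      (Finset.le_sup (f := fun m => lev (i m)) (Finset.mem_univ m))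

theorem summable_cterm (h : IsLev par r lev) {n : ℕ} (hn : n ≠ 0) (lam w : Fin p → ℝ)
    (hc : |lam r| < 1) (i : Fin n → Fin p) : Summable (cterm par lam w i) := by
  refine tuple_ind h (P := fun i => Summable (cterm par lam w i)) ?_ ?_ i
  · simp only [funext (cterm_root h hn lam w)]
    exact (summable_geometric_of_abs_lt_one (abs_pow_lt hc hn)).mul_right _
  · intro i hi
    rw [← summable_nat_add_iff 1]
    simp only [cterm_succ]
    exact hi.mul_left _

theorem cum_rec (h : IsLev par r lev) {n : ℕ} (hn : n ≠ 0) (lam w : Fin p → ℝ)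
    (hc : |lam r| < 1) (i : Fin n → Fin p) :
    cum par lam w i = cterm par lam w i 0 + (∏ m, lam (i m)) * cum par lam w (par ∘ i) := by
  rw [cum, (summable_cterm h hn lam w hc i).tsum_eq_zero_add]
  simp only [cterm_succ, tsum_mul_left]
  rfl

theorem cum_nonconst (h : IsLev par r lev) {n : ℕ} (hn : n ≠ 0) (lam w : Fin p → ℝ)
    (hc : |lam r| < 1) (i : Fin n → Fin p) (hi : ¬ ∃ u, ∀ m, i m = u) :
    cum par lam w i = (∏ m, lam (i m)) * cum par lam w (par ∘ i) := by
  rw [cum_rec h hn lam w hc, cterm_zero_nonconst lam w i hi, zero_add]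

theorem cum_const (h : IsLev par r lev) {n : ℕ} (hn : n ≠ 0) (lam w : Fin p → ℝ)
    (hc : |lam r| < 1) (t : Fin p) :
    cum par lam w (fun _ : Fin n => t)
      = w t + lam t ^ n * cum par lam w (fun _ : Fin n => par t) := by
  rw [cum_rec h hn lam w hc, cterm_zero_const hn]
  simp [Function.comp_def]

theorem cum_add_smul (h : IsLev par r lev) {n : ℕ} (hn : n ≠ 0) (lam w w' : Fin p → ℝ)
    (hc : |lam r| < 1) (s : ℝ) (i : Fin n → Fin p) :
    cum par lam (fun v => w v + s * w' v) i = cum par lam w i + s * cum par lam w' i := by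
  have h1 := summable_cterm h hn lam w hc i
  have h2 := summable_cterm h hn lam w' hc i
  rw [cum, cum, cum, ← tsum_mul_left, ← h1.tsum_add (h2.mul_left s)]
  refine tsum_congr fun l => ?_
  simp only [cterm, Finset.mul_sum, ← Finset.sum_add_distrib]
  refine Finset.sum_congr rfl fun u _ => ?_
  ring

theorem cum_diag (h : IsLev par r lev) {n : ℕ} (hn : n ≠ 0) (lam D : Fin p → ℝ)
    (hc : |lam r| < 1) (t : Fin p) :
    cum par lam (fun v => D v - lam v ^ n * D (par v)) (fun _ : Fin n => t) = D t := by
  refine h.ind (P := fun t =>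
    cum par lam (fun v => D v - lam v ^ n * D (par v)) (fun _ : Fin n => t) = D t) ?_ ?_ t
  · have h1 := cum_const h hn lam (fun v => D v - lam v ^ n * D (par v)) hc r
    simp only [h.par_root] at h1
    have h2 := (abs_lt.1 (abs_pow_lt hc hn)).2
    have h3 : (1 - lam r ^ n) *
      (cum par lam (fun v => D v - lam v ^ n * D (par v)) (fun _ : Fin n => r) - D r) = 0 := by
      linear_combination h1
    rcases mul_eq_zero.1 h3 with h4 | h4
    · linarith
    · linarith
  · intro i _ hi
    rw [cum_const h hn lam _ hc, hi]
    ring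

/-- path weight -/
def pathW {p : ℕ} (par : Fin p → Fin p) (lam : Fin p → ℝ) (i : Fin p) (K : ℕ) : ℝ :=
  ∏ k ∈ Finset.range K, lam (par^[k] i)

theorem cum_iter (h : IsLev par r lev) {n : ℕ} (hn : n ≠ 0) (lam w : Fin p → ℝ)
    (hc : |lam r| < 1) (K : ℕ) (i : Fin n → Fin p)
    (hi : ∀ k < K, ¬ ∃ u, ∀ m, par^[k] (i m) = u) :
    cum par lam w i = (∏ m, pathW par lam (i m) K) * cum par lam w (fun m => par^[K] (i m)) := by
  induction K with
  | zero => simp [pathW]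
  | succ K ih =>
    rw [ih (fun k hk => hi k (by omega)), cum_nonconst h hn lam w hc _ (hi K (by omega))]
    simp only [pathW, Finset.prod_range_succ, Finset.prod_mul_distrib,
      Function.iterate_succ_apply', Function.comp_def]
    ring

/-- `g` is the product of edge weights from the root -/
def IsG {p : ℕ} (par : Fin p → Fin p) (r : Fin p) (lam g : Fin p → ℝ) : Prop :=
  g r = 1 ∧ ∀ v, v ≠ r → lam v * g (par v) = g v

theorem exists_isG (h : IsLev par r lev) (lam : Fin p → ℝ) : ∃ g, IsG par r lam g := by
  refine ⟨fun v => pathW par lam v (lev v), ?_, fun v hv => ?_⟩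
  · simp [h.lev_root, pathW]
  · have : lev v ≠ 0 := fun e => hv (h.lev_eq_zero.1 e)
    obtain ⟨k, hk⟩ := Nat.exists_eq_succ_of_ne_zero this
    beta_reduce
    rw [h.lev_par, hk]
    simp [pathW, Finset.prod_range_succ', mul_comm]

theorem IsG.ne_zero (h : IsLev par r lev) {lam g : Fin p → ℝ} (hg : IsG par r lam g)
    (hl : ∀ v, v ≠ r → lam v ≠ 0) (v : Fin p) : g v ≠ 0 := by
  refine h.ind (P := fun v => g v ≠ 0) ?_ ?_ v
  · rw [hg.1]; exact one_ne_zero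
  · intro i hi hp
    rw [← hg.2 i hi]
    exact mul_ne_zero (hl i hi) hp

theorem pathW_mul (h : IsLev par r lev) {lam g : Fin p → ℝ} (hg : IsG par r lam g)
    (i : Fin p) (K : ℕ) :
    pathW par lam i K * g (par^[K] i) = g i * lam r ^ (K - lev i) := by
  induction K with
  | zero => simp [pathW]
  | succ K ih =>
    rw [pathW, Finset.prod_range_succ, ← pathW, Function.iterate_succ_apply']
    by_cases hK : par^[K] i = r
    · have := (h i K).1 hK
      have e : K + 1 - lev i = (K - lev i) + 1 := by omega
      rw [hK, h.par_root, e, pow_succ]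
      rw [hK] at ih
      linear_combination (lam r) * ih
    · have : ¬ lev i ≤ K := fun hh => hK ((h i K).2 hh)
      have e : K + 1 - lev i = K - lev i := by omega
      rw [e, ← ih, ← hg.2 _ hK]
      ring

theorem cum_meetT (h : IsLev par r lev) {n : ℕ} (hn : n ≠ 0) (lam w g : Fin p → ℝ)
    (hc : |lam r| < 1) (hg : IsG par r lam g) {i : Fin n → Fin p} {K : ℕ} {t : Fin p}
    (hm : MeetT par i K t) :
    cum par lam w i * g t ^ n
      = (∏ m, (g (i m) * lam r ^ (K - lev (i m)))) * cum par lam w (fun _ : Fin n => t) := by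
  rw [cum_iter h hn lam w hc K i hm.2]
  simp only [← pathW_mul h hg, Finset.prod_mul_distrib, hm.1]
  simp only [Finset.prod_const, Finset.card_univ, Fintype.card_fin]
  ring

theorem const2 (t : Fin p) : ![t, t] = fun _ => t := by
  funext m; fin_cases m <;> rfl
theorem const3 (t : Fin p) : ![t, t, t] = fun _ => t := by
  funext m; fin_cases m <;> rfl

theorem cum2_meet (h : IsLev par r lev) (lam w g : Fin p → ℝ)
    (hc : |lam r| < 1) (hg : IsG par r lam g) {a b : Fin p} {K : ℕ} {t : Fin p}
    (hm : Meet par a b K t) :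
    cum par lam w ![a, b] * g t ^ 2
      = (g a * lam r ^ (K - lev a)) * (g b * lam r ^ (K - lev b)) * cum par lam w ![t, t] := by
  have := cum_meetT h (n := 2) (by omega) lam w g hc hg (i := ![a, b]) (K := K) (t := t) ⟨?_, ?_⟩
  · rw [this, const2, Fin.prod_univ_two]
    rfl
  · intro m; fin_cases m
    · exact hm.1
    · exact hm.2.1
  · rintro k hk ⟨u, hu⟩
    exact hm.2.2 k hk ((hu 0).trans (hu 1).symm)

theorem cum3_meet (h : IsLev par r lev) (lam w g : Fin p → ℝ)
    (hc : |lam r| < 1) (hg : IsG par r lam g) {a b : Fin p} {K : ℕ} {t : Fin p}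
    (hm : Meet par a b K t) :
    cum par lam w ![a, a, b] * g t ^ 3
      = (g a * lam r ^ (K - lev a)) * (g a * lam r ^ (K - lev a)) * (g b * lam r ^ (K - lev b))
        * cum par lam w ![t, t, t] := by
  have := cum_meetT h (n := 3) (by omega) lam w g hc hg (i := ![a, a, b]) (K := K) (t := t) ⟨?_, ?_⟩
  · rw [this, const3, Fin.prod_univ_three]
    rfl
  · intro m; fin_cases m
    · exact hm.1
    · exact hm.1
    · exact hm.2.1
  · rintro k hk ⟨u, hu⟩
    exact hm.2.2 k hk ((hu 0).trans (hu 2).symm)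

theorem cum3_meet' (h : IsLev par r lev) (lam w g : Fin p → ℝ)
    (hc : |lam r| < 1) (hg : IsG par r lam g) {a b : Fin p} {K : ℕ} {t : Fin p}
    (hm : Meet par a b K t) :
    cum par lam w ![a, b, b] * g t ^ 3
      = (g a * lam r ^ (K - lev a)) * (g b * lam r ^ (K - lev b)) * (g b * lam r ^ (K - lev b))
        * cum par lam w ![t, t, t] := by
  have := cum_meetT h (n := 3) (by omega) lam w g hc hg (i := ![a, b, b]) (K := K) (t := t) ⟨?_, ?_⟩
  · rw [this, const3, Fin.prod_univ_three]
    rfl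
  · intro m; fin_cases m
    · exact hm.1
    · exact hm.2.1
    · exact hm.2.1
  · rintro k hk ⟨u, hu⟩
    exact hm.2.2 k hk ((hu 0).trans (hu 2).symm)

/-- The two trees give the same tensor when the diagonal entries agree. -/
theorem cum_transfer {par' : Fin p → Fin p} (h : IsLev par r lev) (h' : IsLev par' r lev)
    (htr : ∀ i j K t, Meet par i j K t → Meet par' i j K t) {n : ℕ} (hn : n ≠ 0)
    (lam lam' w g : Fin p → ℝ) (hc : |lam r| < 1) (hcc : lam' r = lam r)
    (hg : IsG par r lam g) (hg' : IsG par' r lam' g) (hg0 : ∀ v, g v ≠ 0)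
    (i : Fin n → Fin p) :
    cum par' lam' (fun v => cum par lam w (fun _ : Fin n => v)
      - lam' v ^ n * cum par lam w (fun _ : Fin n => par' v)) i = cum par lam w i := by
  obtain ⟨K, t, hm⟩ := exists_meetT h i
  have hm' := meetT_transfer h htr hm
  have e1 := cum_meetT h hn lam w g hc hg hm
  have e2 := cum_meetT h' hn lam' (fun v => cum par lam w (fun _ : Fin n => v)
      - lam' v ^ n * cum par lam w (fun _ : Fin n => par' v)) g (hcc ▸ hc) hg' hm'
  rw [cum_diag h' hn lam' (fun v => cum par lam w (fun _ : Fin n => v)) (hcc ▸ hc), hcc, ← e1] at e2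
  exact mul_right_cancel₀ (pow_ne_zero _ (hg0 t)) e2

theorem continuous_cum (h : IsLev par r lev) {n : ℕ} (hn : n ≠ 0) (lam : ℝ → Fin p → ℝ)
    (w : Fin p → ℝ) (hcont : ∀ v, Continuous fun e => lam e v) (c : ℝ) (hlc : ∀ e, lam e r = c)
    (hc : |c| < 1) (i : Fin n → Fin p) : Continuous fun e => cum par (lam e) w i := by
  refine tuple_ind h (P := fun i => Continuous fun e => cum par (lam e) w i) ?_ ?_ i
  · have : (fun e => cum par (lam e) w (fun _ : Fin n => r)) = fun _ => ∑' l, (c ^ n) ^ l * w r := by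
      funext e
      rw [cum]
      simp only [cterm_root h hn, hlc]
    rw [this]
    exact continuous_const
  · intro i hi
    have : (fun e => cum par (lam e) w i) = fun e => cterm par (fun _ => 0) w i 0
        + (∏ m, lam e (i m)) * cum par (lam e) w (par ∘ i) := by
      funext e
      rw [cum_rec h hn (lam e) w (by rw [hlc]; exact hc)]
      simp [cterm]
    rw [this]
    exact continuous_const.add ((continuous_finsetProd _ fun m _ => hcont _).mul hi)

/-! Model membership. -/

theorem model_imp (h : IsLev par r lev) {A : Matrix (Fin p) (Fin p) ℝ} {w₂ w₃ : Fin p → ℝ}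
    (hm : treeModel par r A w₂ w₃) :
    ∃ lam : Fin p → ℝ, A = treeMat par lam ∧ |lam r| < 1 := by
  obtain ⟨h1, h2, -, -⟩ := hm
  have hA : A = treeMat par (fun v => A v (par v)) := by
    ext v u
    rw [treeMat]
    split_ifs with hu
    · rw [hu]
    · apply h1
      rintro (⟨-, h3⟩ | ⟨h3, h4⟩)
      · exact hu h3
      · apply hu
        rw [h3, h4, h.par_root]
  refine ⟨_, hA, ?_⟩
  simp only [h.par_root]
  have hs : ((A r r : ℝ) : ℂ) ∈ spectrum ℂ (A.map (algebraMap ℝ ℂ)) := by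
    rw [spectrum.mem_iff]
    intro hu
    obtain ⟨B, hB⟩ := hu.exists_right_inv
    have h3 := congrFun (congrFun hB r) r
    rw [Matrix.mul_apply, Finset.sum_eq_zero] at h3
    · simp at h3
    · intro x _
      have : (algebraMap ℂ (Matrix (Fin p) (Fin p) ℂ) ((A r r : ℝ) : ℂ)
          - A.map (algebraMap ℝ ℂ)) r x = 0 := by
        rw [Matrix.sub_apply, Matrix.algebraMap_matrix_apply]
        split_ifs with hx
        · subst hx; simp
        · have : A r x = 0 := by
            apply h1
            rintro (⟨h3, -⟩ | ⟨h3, h4⟩)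
            · exact h3 rfl
            · exact hx h3.symm
          simp [this]
      rw [this, zero_mul]
  have := h2 _ hs
  rwa [Complex.norm_real, Real.norm_eq_abs] at this

theorem model_of (h : IsLev par r lev) {lam w₂ w₃ : Fin p → ℝ} (hc : |lam r| < 1)
    (h2 : ∀ i, 0 < w₂ i) (h3 : ∀ i, w₃ i ≠ 0) : treeModel par r (treeMat par lam) w₂ w₃ := by
  refine ⟨fun u v hu => ?_, fun μ hμ => ?_, h2, h3⟩
  · rw [treeMat, if_neg]
    intro e
    apply hu
    by_cases hv : v = r
    · right
      rw [hv, h.par_root] at e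
      exact ⟨e, hv⟩
    · left
      exact ⟨hv, e⟩
  · rw [spectrum.mem_iff, Matrix.isUnit_iff_isUnit_det, isUnit_iff_ne_zero, not_not] at hμ
    obtain ⟨x, hx0, hx⟩ := Matrix.exists_mulVec_eq_zero_iff.2 hμ
    have key : ∀ i, μ * x i = lam i * x (par i) := by
      intro i
      have := congrFun hx i
      rw [Matrix.sub_mulVec] at this
      have e1 : (algebraMap ℂ (Matrix (Fin p) (Fin p) ℂ) μ *ᵥ x) i = μ * x i := by
        rw [Algebra.algebraMap_eq_smul_one, Matrix.smul_mulVec, Matrix.one_mulVec]; rfl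
      have e2 : ((treeMat par lam).map (algebraMap ℝ ℂ) *ᵥ x) i = lam i * x (par i) := by
        simp [Matrix.mulVec, dotProduct, treeMat, apply_ite, ite_mul]
      rw [Pi.sub_apply, e1, e2, Pi.zero_apply] at this
      linear_combination this
    by_contra hlt
    push Not at hlt
    have hμ0 : μ ≠ 0 := by
      rintro rfl
      simp at hlt
      linarith
    apply hx0
    funext i
    refine h.ind (P := fun i => x i = 0) ?_ ?_ i
    · have := key r
      rw [h.par_root] at this
      by_contra hxr
      have e := mul_right_cancel₀ hxr this
      rw [e, Complex.norm_real, Real.norm_eq_abs] at hlt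
      linarith
    · intro i _ hi
      have := key i
      rw [hi, mul_zero] at this
      exact (mul_eq_zero.1 this).resolve_left hμ0

end cum
theorem poly_line {σ : Type*} (f : MvPolynomial σ ℝ) (a b : σ → ℝ) (s0 : ℝ)
    (hz : ∀ s > s0, MvPolynomial.eval (fun x => a x + s * b x) f = 0) :
    MvPolynomial.eval a f = 0 := by
  set q : Polynomial ℝ := MvPolynomial.aeval
    (fun x => Polynomial.C (a x) + Polynomial.X * Polynomial.C (b x)) f with hq
  have he : ∀ s, q.eval s = MvPolynomial.eval (fun x => a x + s * b x) f := by
    intro s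
    rw [hq, ← Polynomial.coe_evalRingHom, MvPolynomial.aeval_def, ← MvPolynomial.coe_eval₂Hom,
      ← RingHom.comp_apply]
    rw [MvPolynomial.comp_eval₂Hom, MvPolynomial.coe_eval₂Hom, MvPolynomial.eval,
      MvPolynomial.coe_eval₂Hom]
    congr 1
    · ext x; simp
    · funext x; simp; ring
  have h0 : q = 0 := by
    apply Polynomial.eq_zero_of_infinite_isRoot
    refine (Set.Ioi_infinite s0).mono fun s hs => ?_
    rw [Set.mem_ofPred_eq, Polynomial.IsRoot.def, he]
    exact hz s hs
  have := he 0
  rw [h0] at this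
  simpa using this.symm

section main
variable {p : ℕ} {parG parH : Fin p → Fin p} {r : Fin p} {lev : Fin p → ℕ}

theorem vanish_transfer_nonzero (hG : IsLev parG r lev) (hH : IsLev parH r lev)
    (htr : ∀ i j K t, Meet parH i j K t → Meet parG i j K t)
    (f : MvPolynomial ((Fin p × Fin p) ⊕ (Fin p × Fin p × Fin p)) ℝ)
    (hf : ∀ (A : Matrix (Fin p) (Fin p) ℝ) (w₂ w₃ : Fin p → ℝ),
            treeModel parG r A w₂ w₃ → evalCumulants p A w₂ w₃ f = 0)
    (lam w₂ w₃ : Fin p → ℝ) (hc : |lam r| < 1) (hl : ∀ v, v ≠ r → lam v ≠ 0) :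
    evalCumulants p (treeMat parH lam) w₂ w₃ f = 0 := by
  obtain ⟨g, hg⟩ := exists_isG hH lam
  have hg0 := hg.ne_zero hH hl
  set lam' : Fin p → ℝ := fun v => if v = r then lam r else g v / g (parG v) with hlam'
  have hcc : lam' r = lam r := by simp [hlam']
  have hc' : |lam' r| < 1 := hcc ▸ hc
  have hg' : IsG parG r lam' g := by
    refine ⟨hg.1, fun v hv => ?_⟩
    simp only [hlam', if_neg hv]
    exact div_mul_cancel₀ _ (hg0 _)
  set W2 : Fin p → ℝ := fun v => cum parH lam w₂ (fun _ : Fin 2 => v)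
      - lam' v ^ 2 * cum parH lam w₂ (fun _ : Fin 2 => parG v) with hW2
  set W3 : Fin p → ℝ := fun v => cum parH lam w₃ (fun _ : Fin 3 => v)
      - lam' v ^ 3 * cum parH lam w₃ (fun _ : Fin 3 => parG v) with hW3
  have t2 : ∀ i : Fin 2 → Fin p, cum parG lam' W2 i = cum parH lam w₂ i :=
    cum_transfer hH hG htr (by omega) lam lam' w₂ g hc hcc hg hg' hg0
  have t3 : ∀ i : Fin 3 → Fin p, cum parG lam' W3 i = cum parH lam w₃ i :=
    cum_transfer hH hG htr (by omega) lam lam' w₃ g hc hcc hg hg' hg0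
  rw [evalCumulants]
  refine poly_line f _ (Sum.elim (fun x => cum parG lam' (fun _ => 1) ![x.1, x.2])
    (fun x => cum parG lam' (fun _ => 1) ![x.1, x.2.1, x.2.2])) (∑ v, |W2 v| + ∑ v, |W3 v|) ?_
  intro s hs
  have b2 : ∀ v, |W2 v| ≤ ∑ v, |W2 v| := fun v =>
    Finset.single_le_sum (f := fun v => |W2 v|) (fun _ _ => abs_nonneg _) (Finset.mem_univ v)
  have b3 : ∀ v, |W3 v| ≤ ∑ v, |W3 v| := fun v =>
    Finset.single_le_sum (f := fun v => |W3 v|) (fun _ _ => abs_nonneg _) (Finset.mem_univ v)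
  have n2 : 0 ≤ ∑ v, |W2 v| := Finset.sum_nonneg fun _ _ => abs_nonneg _
  have n3 : 0 ≤ ∑ v, |W3 v| := Finset.sum_nonneg fun _ _ => abs_nonneg _
  have hmod : treeModel parG r (treeMat parG lam') (fun v => W2 v + s * 1)
      (fun v => W3 v + s * 1) := by
    refine model_of hG hc' (fun v => ?_) (fun v => ?_)
    · have := b2 v
      have := neg_abs_le (W2 v)
      linarith
    · have := b3 v
      have := neg_abs_le (W3 v)
      apply ne_of_gt
      linarith
  have := hf _ _ _ hmod
  rw [evalCumulants] at this
  rw [← this]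
  congr 1
  apply congrArg
  funext x
  rcases x with x | x
  · simp only [Sum.elim_inl, steady_eq_cum]
    rw [cum_add_smul hG (by omega) lam' W2 (fun _ => 1) hc' s, t2]
  · simp only [Sum.elim_inr, steady_eq_cum]
    rw [cum_add_smul hG (by omega) lam' W3 (fun _ => 1) hc' s, t3]

theorem vanish_transfer (hG : IsLev parG r lev) (hH : IsLev parH r lev)
    (htr : ∀ i j K t, Meet parH i j K t → Meet parG i j K t)
    (f : MvPolynomial ((Fin p × Fin p) ⊕ (Fin p × Fin p × Fin p)) ℝ)
    (hf : ∀ (A : Matrix (Fin p) (Fin p) ℝ) (w₂ w₃ : Fin p → ℝ),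
            treeModel parG r A w₂ w₃ → evalCumulants p A w₂ w₃ f = 0)
    (A : Matrix (Fin p) (Fin p) ℝ) (w₂ w₃ : Fin p → ℝ) (hm : treeModel parH r A w₂ w₃) :
    evalCumulants p A w₂ w₃ f = 0 := by
  obtain ⟨lam, rfl, hc⟩ := model_imp hH hm
  set L : ℝ → Fin p → ℝ := fun e v => if v = r then lam r else lam v + e with hL
  have hLr : ∀ e, L e r = lam r := fun e => by simp [hL]
  have hL0 : L 0 = lam := by
    funext v
    simp only [hL]
    split_ifs with hv
    · rw [hv]
    · rw [add_zero]
  have hLc : ∀ v, Continuous fun e => L e v := by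
    intro v
    simp only [hL]
    split_ifs
    · exact continuous_const
    · fun_prop
  have hcont : Continuous fun e => evalCumulants p (treeMat parH (L e)) w₂ w₃ f := by
    simp only [evalCumulants]
    refine (MvPolynomial.continuous_eval f).comp (continuous_pi fun x => ?_)
    rcases x with x | x
    · simp only [Sum.elim_inl, steady_eq_cum]
      exact continuous_cum hH (by omega) L w₂ hLc _ hLr hc _
    · simp only [Sum.elim_inr, steady_eq_cum]
      exact continuous_cum hH (by omega) L w₃ hLc _ hLr hc _
  have hfin : {e : ℝ | ∃ v, lam v + e = 0}.Finite := by
    refine (Set.finite_range (fun v => - lam v)).subset ?_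
    rintro e ⟨v, hv⟩
    exact ⟨v, by simp only; linarith⟩
  have hev : ∀ᶠ e in nhdsWithin (0:ℝ) {0}ᶜ,
      evalCumulants p (treeMat parH (L e)) w₂ w₃ f = 0 := by
    have h1 : ∀ᶠ e in nhdsWithin (0:ℝ) {0}ᶜ, e ∉ {e : ℝ | ∃ v, lam v + e = 0} := by
      have hcl : IsClosed ({e : ℝ | ∃ v, lam v + e = 0} \ {0}) := (hfin.subset Set.sdiff_subset).isClosed
      have : ∀ᶠ e in nhds (0:ℝ), e ∈ ({e : ℝ | ∃ v, lam v + e = 0} \ {0})ᶜ :=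
        hcl.isOpen_compl.mem_nhds (by simp)
      rw [eventually_nhdsWithin_iff]
      filter_upwards [this] with e he h0 h2
      exact he ⟨h2, h0⟩
    filter_upwards [h1] with e he
    refine vanish_transfer_nonzero hG hH htr f hf (L e) w₂ w₃ (by rw [hLr]; exact hc) ?_
    intro v hv h0
    apply he
    refine ⟨v, ?_⟩
    simpa [hL, hv] using h0
  have hlim : Filter.Tendsto (fun e => evalCumulants p (treeMat parH (L e)) w₂ w₃ f)
      (nhdsWithin (0:ℝ) {0}ᶜ) (nhds (evalCumulants p (treeMat parH (L 0)) w₂ w₃ f)) :=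
    (hcont.tendsto 0).mono_left nhdsWithin_le_nhds
  have hlim2 : Filter.Tendsto (fun e => evalCumulants p (treeMat parH (L e)) w₂ w₃ f)
      (nhdsWithin (0:ℝ) {0}ᶜ) (nhds 0) :=
    tendsto_const_nhds.congr' (hev.mono fun e he => he.symm)
  rw [← hL0]
  exact tendsto_nhds_unique hlim hlim2

end main

/-! Test polynomials -/

/-- variable `s_{ab}` -/
noncomputable def sv {p : ℕ} (a b : Fin p) :
    MvPolynomial ((Fin p × Fin p) ⊕ (Fin p × Fin p × Fin p)) ℝ := MvPolynomial.X (Sum.inl (a, b))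
/-- variable `t_{abc}` -/
noncomputable def tv {p : ℕ} (a b c : Fin p) :
    MvPolynomial ((Fin p × Fin p) ⊕ (Fin p × Fin p × Fin p)) ℝ :=
  MvPolynomial.X (Sum.inr (a, b, c))

/-- root detection -/
noncomputable def polyR {p : ℕ} (v j : Fin p) :
    MvPolynomial ((Fin p × Fin p) ⊕ (Fin p × Fin p × Fin p)) ℝ :=
  tv v v j * tv v j j * sv v v ^ 3 - tv v v v ^ 2 * sv v j ^ 3

/-- level detection -/
noncomputable def polyP {p : ℕ} (r i j : Fin p) (a : ℕ) :
    MvPolynomial ((Fin p × Fin p) ⊕ (Fin p × Fin p × Fin p)) ℝ :=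
  (tv r r i * sv r r) * (sv r j * tv r r r) ^ a - (tv r r j * sv r r) ^ a * (sv r i * tv r r r)

/-- top detection -/
noncomputable def polyE {p : ℕ} (r i j t : Fin p) :
    MvPolynomial ((Fin p × Fin p) ⊕ (Fin p × Fin p × Fin p)) ℝ :=
  sv i j * (sv r t ^ 2 * tv r r r) ^ 2 * (tv r r i * sv r r ^ 2) * (tv r r j * sv r r ^ 2)
  - (sv r i ^ 2 * tv r r r) * (sv r j ^ 2 * tv r r r) * (tv r r t * sv r r ^ 2) ^ 2 * sv t t

/-- vanishing on the model -/
def Van {p : ℕ} (par : Fin p → Fin p) (r : Fin p)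
    (f : MvPolynomial ((Fin p × Fin p) ⊕ (Fin p × Fin p × Fin p)) ℝ) : Prop :=
  ∀ (A : Matrix (Fin p) (Fin p) ℝ) (w₂ w₃ : Fin p → ℝ),
            treeModel par r A w₂ w₃ → evalCumulants p A w₂ w₃ f = 0

section test
variable {p : ℕ} {par : Fin p → Fin p} {r : Fin p} {lev : Fin p → ℕ}

theorem eval_polyR (lam w₂ w₃ : Fin p → ℝ) (v j : Fin p) :
    evalCumulants p (treeMat par lam) w₂ w₃ (polyR v j) =
      cum par lam w₃ ![v, v, j] * cum par lam w₃ ![v, j, j] * cum par lam w₂ ![v, v] ^ 3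
      - cum par lam w₃ ![v, v, v] ^ 2 * cum par lam w₂ ![v, j] ^ 3 := by
  simp [evalCumulants, polyR, sv, tv, steady_eq_cum]

theorem eval_polyP (lam w₂ w₃ : Fin p → ℝ) (r i j : Fin p) (a : ℕ) :
    evalCumulants p (treeMat par lam) w₂ w₃ (polyP r i j a) =
      (cum par lam w₃ ![r, r, i] * cum par lam w₂ ![r, r]) *
        (cum par lam w₂ ![r, j] * cum par lam w₃ ![r, r, r]) ^ a
      - (cum par lam w₃ ![r, r, j] * cum par lam w₂ ![r, r]) ^ a *
        (cum par lam w₂ ![r, i] * cum par lam w₃ ![r, r, r]) := by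
  simp [evalCumulants, polyP, sv, tv, steady_eq_cum]

theorem eval_polyE (lam w₂ w₃ : Fin p → ℝ) (r i j t : Fin p) :
    evalCumulants p (treeMat par lam) w₂ w₃ (polyE r i j t) =
      cum par lam w₂ ![i, j] * (cum par lam w₂ ![r, t] ^ 2 * cum par lam w₃ ![r, r, r]) ^ 2
        * (cum par lam w₃ ![r, r, i] * cum par lam w₂ ![r, r] ^ 2)
        * (cum par lam w₃ ![r, r, j] * cum par lam w₂ ![r, r] ^ 2)
      - (cum par lam w₂ ![r, i] ^ 2 * cum par lam w₃ ![r, r, r])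
        * (cum par lam w₂ ![r, j] ^ 2 * cum par lam w₃ ![r, r, r])
        * (cum par lam w₃ ![r, r, t] * cum par lam w₂ ![r, r] ^ 2) ^ 2
        * cum par lam w₂ ![t, t] := by
  simp [evalCumulants, polyE, sv, tv, steady_eq_cum]

theorem root_formulas (h : IsLev par r lev) (lam w₂ w₃ g : Fin p → ℝ)
    (hc : |lam r| < 1) (hg : IsG par r lam g) (i : Fin p) :
    cum par lam w₂ ![r, i] = lam r ^ lev i * g i * cum par lam w₂ ![r, r] ∧
    cum par lam w₃ ![r, r, i] = lam r ^ lev i * lam r ^ lev i * g i * cum par lam w₃ ![r, r, r] ∧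
    cum par lam w₃ ![r, i, i] = lam r ^ lev i * g i * g i * cum par lam w₃ ![r, r, r] := by
  have h1 := cum2_meet h lam w₂ g hc hg (meet_root h i)
  have h2 := cum3_meet h lam w₃ g hc hg (meet_root h i)
  have h3 := cum3_meet' h lam w₃ g hc hg (meet_root h i)
  simp only [hg.1, h.lev_root, Nat.sub_zero, Nat.sub_self, pow_zero, one_pow, mul_one, one_mul]
    at h1 h2 h3
  exact ⟨h1, h2, h3⟩

theorem van_polyR (h : IsLev par r lev) (j : Fin p) : Van par r (polyR r j) := by
  intro A w₂ w₃ hm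
  obtain ⟨lam, rfl, hc⟩ := model_imp h hm
  obtain ⟨g, hg⟩ := exists_isG h lam
  obtain ⟨h1, h2, h3⟩ := root_formulas h lam w₂ w₃ g hc hg j
  rw [eval_polyR, h1, h2, h3]
  ring

theorem van_polyP (h : IsLev par r lev) (i j : Fin p) (a : ℕ) (ha : lev i = lev j * a) :
    Van par r (polyP r i j a) := by
  intro A w₂ w₃ hm
  obtain ⟨lam, rfl, hc⟩ := model_imp h hm
  obtain ⟨g, hg⟩ := exists_isG h lam
  obtain ⟨h1, h2, -⟩ := root_formulas h lam w₂ w₃ g hc hg i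
  obtain ⟨k1, k2, -⟩ := root_formulas h lam w₂ w₃ g hc hg j
  rw [eval_polyP, h1, h2, k1, k2, ha, pow_mul]
  simp only [mul_pow]
  ring

theorem van_polyE (h : IsLev par r lev) (i j t : Fin p) (hl : lev i = lev j)
    (ht : IsEqTop par i j t) : Van par r (polyE r i j t) := by
  intro A w₂ w₃ hm
  obtain ⟨lam, rfl, hc⟩ := model_imp h hm
  obtain ⟨g, hg⟩ := exists_isG h lam
  obtain ⟨h1, h2, -⟩ := root_formulas h lam w₂ w₃ g hc hg i
  obtain ⟨k1, k2, -⟩ := root_formulas h lam w₂ w₃ g hc hg j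
  obtain ⟨m1, m2, -⟩ := root_formulas h lam w₂ w₃ g hc hg t
  have h3 := cum2_meet h lam w₂ g hc hg ((isEqTop_iff_meet h hl).1 ht)
  have e1 : lev i - lev t - lev i = 0 := by omega
  have e2 : lev i - lev t - lev j = 0 := by omega
  rw [e1, e2, pow_zero, mul_one, mul_one] at h3
  rw [eval_polyE, h1, h2, k1, k2, m1, m2]
  generalize cum par lam w₂ ![i, j] = X at *
  generalize cum par lam w₂ ![r, r] = S at *
  generalize cum par lam w₃ ![r, r, r] = T at *
  generalize cum par lam w₂ ![t, t] = Y at *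
  generalize lam r ^ lev i = a at *
  generalize lam r ^ lev j = b at *
  generalize lam r ^ lev t = d at *
  linear_combination (d^4 * g t^2 * S^8 * T^4 * a^2 * b^2 * g i * g j) * h3

/-- the test point -/
theorem test_point (h : IsLev par r lev) : ∃ (lam w₂ w₃ D : Fin p → ℝ),
    treeModel par r (treeMat par lam) w₂ w₃ ∧ lam r = 1/2 ∧ IsG par r lam (fun _ => 1) ∧
    (∀ v, 0 < D v) ∧ Function.Injective D ∧
    (∀ v, cum par lam w₂ ![v, v] = D v) ∧ (∀ v, cum par lam w₃ ![v, v, v] = D v) := by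
  set lam : Fin p → ℝ := fun v => if v = r then 1/2 else 1 with hlam
  set D : Fin p → ℝ := fun v => p * lev v + v + 1 with hD
  have hlr : lam r = 1/2 := by simp [hlam]
  have hc : |lam r| < 1 := by rw [hlr, abs_of_pos] <;> norm_num
  have hpos : ∀ v, 0 < D v := fun v => by simp only [hD]; positivity
  have hinc : ∀ n, n ≠ 0 → ∀ v, 0 < D v - lam v ^ n * D (par v) := by
    intro n hn v
    by_cases hv : v = r
    · rw [hv, h.par_root, hlr]
      have h1 := hpos r
      have h2 : (1/2 : ℝ) ^ n < 1 := pow_lt_one₀ (by norm_num) (by norm_num) hn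
      nlinarith
    · have h1 : lam v = 1 := by simp [hlam, hv]
      have h2 : lev v ≠ 0 := fun e => hv (h.lev_eq_zero.1 e)
      have h3 : lev v = lev (par v) + 1 := by rw [h.lev_par]; omega
      have h4 : ((par v : Fin p) : ℝ) < p := by exact_mod_cast (par v).2
      have h5 : (0:ℝ) ≤ ((v : Fin p) : ℝ) := by positivity
      rw [h1, one_pow, one_mul]
      simp only [hD]
      rw [h3]
      push_cast
      linarith
  refine ⟨lam, _, _, D, model_of h hc (hinc 2 (by omega)) (fun v => (hinc 3 (by omega) v).ne'),
    hlr, ⟨rfl, fun v hv => by simp [hlam, hv]⟩, hpos, ?_, ?_, ?_⟩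
  · intro u v huv
    have : p * lev u + u.1 = p * lev v + v.1 := by
      simp only [hD] at huv
      have h1 : (p * lev u + u.1 : ℝ) = p * lev v + v.1 := by linarith
      exact_mod_cast h1
    have h2 := congrArg (· % p) this
    simp only [Nat.mul_add_mod, Nat.mod_eq_of_lt u.2, Nat.mod_eq_of_lt v.2] at h2
    exact Fin.ext h2
  · intro v
    rw [const2]
    exact cum_diag h (by omega) lam D hc v
  · intro v
    rw [const3]
    exact cum_diag h (by omega) lam D hc v

theorem polyR_root (h : IsLev par r lev) (v j : Fin p) (hvj : v ≠ j)
    (hv : Van par r (polyR v j)) : v = r := by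
  by_contra hvr
  obtain ⟨lam, w₂, w₃, D, hm, hlr, hg, hpos, hinj, h2, h3⟩ := test_point h
  have hc : |lam r| < 1 := by rw [hlr, abs_of_pos] <;> norm_num
  obtain ⟨K, t, hmeet⟩ := exists_meet h v j
  have htv : t ≠ v := by
    rintro rfl
    by_cases hl : lev t = lev j
    · have hK := (meet_isEqTop h hl hmeet).2
      rw [Nat.sub_self] at hK
      subst hK
      exact hvj hmeet.2.1.symm
    · exact hvr (hmeet.unique (meet_of_lt h hl)).2
  have e := hv _ _ _ hm
  have a1 := cum2_meet h lam w₂ _ hc hg hmeet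
  have a2 := cum3_meet h lam w₃ _ hc hg hmeet
  have a3 := cum3_meet' h lam w₃ _ hc hg hmeet
  simp only [one_pow, mul_one, one_mul, h2, h3] at a1 a2 a3
  rw [eval_polyR, a1, a2, a3, h2, h3] at e
  have hx : 0 < lam r ^ (K - lev v) := by rw [hlr]; positivity
  have hy : 0 < lam r ^ (K - lev j) := by rw [hlr]; positivity
  generalize lam r ^ (K - lev v) = x at *
  generalize lam r ^ (K - lev j) = y at *
  have e' : (x * y) ^ 3 * (D t * D v) ^ 2 * (D v - D t) = 0 := by linear_combination e
  have := hpos t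
  have := hpos v
  rcases mul_eq_zero.1 e' with e' | e'
  · have : 0 < (x * y) ^ 3 * (D t * D v) ^ 2 := by positivity
    linarith
  · exact htv (hinj (by linarith))

theorem polyP_lev (h : IsLev par r lev) (i j : Fin p) (a : ℕ) 
    (hv : Van par r (polyP r i j a)) : lev i = lev j * a := by
  obtain ⟨lam, w₂, w₃, D, hm, hlr, hg, hpos, hinj, h2, h3⟩ := test_point h
  have hc : |lam r| < 1 := by rw [hlr, abs_of_pos] <;> norm_num
  obtain ⟨h1, h4, -⟩ := root_formulas h lam w₂ w₃ _ hc hg i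
  obtain ⟨k1, k2, -⟩ := root_formulas h lam w₂ w₃ _ hc hg j
  have e := hv _ _ _ hm
  rw [eval_polyP, h1, h4, k1, k2, h2, h3] at e
  have hr := hpos r
  have hx : 0 < lam r ^ (lev i) := by rw [hlr]; positivity
  have hy : 0 < lam r ^ (lev j) := by rw [hlr]; positivity
  have e' : (lam r ^ lev i * D r * D r) * (lam r ^ lev j * D r * D r) ^ a *
      (lam r ^ lev i - (lam r ^ lev j) ^ a) = 0 := by
    simp only [mul_pow] at e ⊢
    linear_combination e
  rcases mul_eq_zero.1 e' with e' | e'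
  · have : 0 < (lam r ^ lev i * D r * D r) * (lam r ^ lev j * D r * D r) ^ a := by positivity
    linarith
  · rw [← pow_mul, hlr, sub_eq_zero] at e'
    exact pow_right_injective₀ (by norm_num) (by norm_num) e'

theorem polyE_top (h : IsLev par r lev) (i j t : Fin p) (hl : lev i = lev j)
    (hv : Van par r (polyE r i j t)) : IsEqTop par i j t := by
  obtain ⟨lam, w₂, w₃, D, hm, hlr, hg, hpos, hinj, h2, h3⟩ := test_point h
  have hc : |lam r| < 1 := by rw [hlr, abs_of_pos] <;> norm_num
  obtain ⟨h1, h4, -⟩ := root_formulas h lam w₂ w₃ _ hc hg i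
  obtain ⟨k1, k2, -⟩ := root_formulas h lam w₂ w₃ _ hc hg j
  obtain ⟨m1, m2, -⟩ := root_formulas h lam w₂ w₃ _ hc hg t
  obtain ⟨K, t', hmeet⟩ := exists_meet h i j
  obtain ⟨htop, hK⟩ := meet_isEqTop h hl hmeet
  have h5 := cum2_meet h lam w₂ _ hc hg hmeet
  have e1 : K - lev i = 0 := by omega
  have e2 : K - lev j = 0 := by omega
  simp only [e1, e2, pow_zero, mul_one, one_pow, one_mul] at h5
  have e := hv _ _ _ hm
  rw [eval_polyE, h1, h4, k1, k2, m1, m2, h5] at e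
  simp only [h2, h3] at e
  have hr := hpos r
  have hx : 0 < lam r ^ (lev i) := by rw [hlr]; positivity
  have hy : 0 < lam r ^ (lev j) := by rw [hlr]; positivity
  have hz : 0 < lam r ^ (lev t) := by rw [hlr]; positivity
  generalize lam r ^ lev i = a at *
  generalize lam r ^ lev j = b at *
  generalize lam r ^ lev t = d at *
  have e' : (d^4 * a^2 * b^2 * D r ^ 12) * (D t' - D t) = 0 := by linear_combination e
  rcases mul_eq_zero.1 e' with e' | e'
  · have : 0 < d^4 * a^2 * b^2 * D r ^ 12 := by positivity
    linarith
  · have := hinj (sub_eq_zero.1 e')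
    rwa [this] at htop

theorem exists_lev_one (hp : 2 ≤ p) (h : IsLev par r lev) : ∃ v, lev v = 1 := by
  have : Nontrivial (Fin p) := Fin.nontrivial_iff_two_le.2 hp
  obtain ⟨v, hv⟩ := exists_ne r
  have h2 : lev v ≠ 0 := fun e => hv (h.lev_eq_zero.1 e)
  refine ⟨par^[lev v - 1] v, ?_⟩
  rw [h.lev_iter]; omega

end test

theorem same_ideal_iff {p : ℕ} (hp : 2 ≤ p) {parG parH : Fin p → Fin p} {rG rH : Fin p}
    {lG lH : Fin p → ℕ} (hG : IsLev parG rG lG) (hH : IsLev parH rH lH) :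
    (∀ f, Van parG rG f ↔ Van parH rH f) ↔ (∀ i, lG i = lH i) ∧
      ∀ i j l, lG i = lG j → (IsEqTop parG i j l ↔ IsEqTop parH i j l) := by
  constructor
  · intro hf
    have hr : rG = rH := by
      have : Nontrivial (Fin p) := Fin.nontrivial_iff_two_le.2 hp
      obtain ⟨j, hj⟩ := exists_ne rG
      exact polyR_root hH rG j hj.symm ((hf _).1 (van_polyR hG j))
    subst hr
    have hlev : ∀ i, lG i = lH i := by
      obtain ⟨j, hj⟩ := exists_lev_one hp hG
      have h1 : ∀ i, lH i = lH j * lG i := fun i =>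
        polyP_lev hH i j (lG i) ((hf _).1 (van_polyP hG i j (lG i) (by rw [hj, one_mul])))
      obtain ⟨k, hk⟩ := exists_lev_one hp hH
      have h2 := h1 k
      rw [hk] at h2
      have h3 : lH j = 1 := Nat.eq_one_of_mul_eq_one_right h2.symm
      intro i
      rw [h1 i, h3, one_mul]
    refine ⟨hlev, fun i j l hl => ⟨fun ht => ?_, fun ht => ?_⟩⟩
    · exact polyE_top hH i j l (by rw [← hlev, ← hlev, hl]) ((hf _).1 (van_polyE hG i j l hl ht))
    · exact polyE_top hG i j l hl
        ((hf _).2 (van_polyE hH i j l (by rw [← hlev, ← hlev, hl]) ht))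
  · rintro ⟨hlev, htop⟩
    obtain rfl : lG = lH := funext hlev
    obtain rfl : rG = rH := hH.lev_eq_zero.1 hG.lev_root
    intro f
    constructor
    · intro hf A w₂ w₃ hm
      exact vanish_transfer hG hH (fun i j K t => meet_transfer hH hG
        (fun i j l hl => (htop i j l hl).2)) f hf A w₂ w₃ hm
    · intro hf A w₂ w₃ hm
      exact vanish_transfer hH hG (fun i j K t => meet_transfer hG hH
        (fun i j l hl => (htop i j l hl).1)) f hf A w₂ w₃ hm

/-- Two directed trees (each with a single self-loop at its root)
define the same third-order ideal if and only if every vertex has the same level in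
both trees and every pair of vertices has the same top of the shortest equitrek
in both trees. -/
theorem stmt_14 (p : ℕ) (hp : 2 ≤ p) (parG parH : Fin p → Fin p) (rG rH : Fin p)
    (hG : parG rG = rG) (hreachG : ∀ i : Fin p, ∃ n : ℕ, parG^[n] i = rG)
    (hH : parH rH = rH) (hreachH : ∀ i : Fin p, ∃ n : ℕ, parH^[n] i = rH) :
    (∀ f : MvPolynomial ((Fin p × Fin p) ⊕ (Fin p × Fin p × Fin p)) ℝ,
        (∀ (A : Matrix (Fin p) (Fin p) ℝ) (w₂ w₃ : Fin p → ℝ),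
            treeModel parG rG A w₂ w₃ → evalCumulants p A w₂ w₃ f = 0)
          ↔ (∀ (A : Matrix (Fin p) (Fin p) ℝ) (w₂ w₃ : Fin p → ℝ),
            treeModel parH rH A w₂ w₃ → evalCumulants p A w₂ w₃ f = 0))
      ↔ ((∀ i : Fin p, Nat.find (hreachG i) = Nat.find (hreachH i)) ∧
          (∀ i j l : Fin p,
            isEquitrekTop parG rG hreachG i j l ↔ isEquitrekTop parH rH hreachH i j l)) := by
  have hlG := isLev_find parG rG hG hreachG
  have hlH := isLev_find parH rH hH hreachH
  refine (same_ideal_iff hp hlG hlH).trans ?_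
  refine and_congr_right fun hlev => ?_
  have hlev' : ∀ i, Nat.find (hreachG i) = Nat.find (hreachH i) := hlev
  have hr : rG = rH := by
    apply hlH.lev_eq_zero.1
    rw [← hlev]
    exact hlG.lev_root
  refine forall_congr' fun i => forall_congr' fun j => forall_congr' fun l => ?_
  unfold isEquitrekTop
  rw [← hlev' i, ← hlev' j, ← hr]
  by_cases hl : Nat.find (hreachG i) = Nat.find (hreachG j)
  · simp only [hl, true_and, ne_eq, not_true_eq_false, false_and, or_false, true_imp_iff]
    rfl
  · simp only [hl, false_and, false_imp_iff]
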